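/- arXiv:cs/0609049 — 2 statements merged into one kernel-verified Lean document; each statement's English description precedes it below -/
import Mathlib

section
/- Let the alphabet and prediction space both be A = D = [0,1] with the squared-error loss l(x,q) = (x−q)². For every n there exist two scandictors (Ψ,F)₁ and (Ψ,F)₂ for V_n such that the following holds: for every ε > 0 there is N such that for all n ≥ N and every scandictor (Ψ,F) for V_n there exists an individual image x ∈ [0,1]^{V_n} with L_{(Ψ,F)}(x) − min{ L_{(Ψ,F)₁}(x), L_{(Ψ,F)₂}(x) } ≥ (1/16 − ε)·n². In particular, no scandictor can achieve vanishing normalized redundancy against these two scandictors on every individual image. -/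
open MeasureTheory Filter Real

namespace Scandiction

variable {A D B : Type*}

/-- The sequence of sites visited by the scanner `Ψ` on the data array `x`:
the site visited at time `t` depends on the values observed at previously visited sites. -/
def visits (Ψ : ∀ t : ℕ, (Fin t → A) → B) (x : B → A) : ℕ → B
  | t => Ψ t fun i : Fin t => x (visits Ψ x i)
  decreasing_by exact i.isLt

/-- A scanner is valid if, for every data array, the visited sites enumerate all of `B`
without repetition. -/
def IsValidScan [Fintype B] (Ψ : ∀ t : ℕ, (Fin t → A) → B) : Prop :=
  ∀ x : B → A, Function.Bijective fun t : Fin (Fintype.card B) => visits Ψ x t.1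

/-- Cumulative loss of the scanner-predictor pair `(Ψ, F)` on the data array `x`. -/
noncomputable def cumLoss [Fintype B] (l : A → D → ℝ)
    (Ψ : ∀ t : ℕ, (Fin t → A) → B) (F : ∀ t : ℕ, (Fin t → A) → D) (x : B → A) : ℝ :=
  ∑ t : Fin (Fintype.card B),
    l (x (visits Ψ x t.1)) (F t.1 fun i : Fin t.1 => x (visits Ψ x i.1))

/-- A scandictor for the finite set of sites `B`, with alphabet `A` and prediction space `D`. -/
structure Scandictor (A D B : Type*) [Fintype B] where
  scan : ∀ t : ℕ, (Fin t → A) → B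
  pred : ∀ t : ℕ, (Fin t → A) → D
  valid : IsValidScan scan

/-- Cumulative loss of a scandictor. -/
noncomputable def sLoss [Fintype B] (l : A → D → ℝ) (S : Scandictor A D B) (x : B → A) : ℝ :=
  cumLoss l S.scan S.pred x

/-- Squared-error loss on the unit interval. -/
noncomputable def sqLoss (a d : unitInterval) : ℝ := ((a : ℝ) - (d : ℝ)) ^ 2

open unitInterval

/-- The midpoint of the unit interval, as a prediction. -/
noncomputable def half : I := ⟨1 / 2, by norm_num, by norm_num⟩

open Classical in
/-- Decoder of a bit hidden in an arbitrarily small perturbation of a value: the endpoints carry no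
information, other rational values carry the bit `0` and irrational values the bit `1`. -/
noncomputable def decode (a : I) : I :=
  if a = 0 ∨ a = 1 then half else if Irrational (a : ℝ) then 1 else 0

lemma decode_of_endpoint {a : I} (h : a = 0 ∨ a = 1) : decode a = half := if_pos h

lemma sqLoss_half_le (a : I) : sqLoss a half ≤ 1 / 4 := by
  have h0 := a.2.1
  have h1 := a.2.2
  simp only [sqLoss, half]
  nlinarith

lemma sqLoss_self (a : I) : sqLoss a a = 0 := by simp [sqLoss]

lemma exists_decode_eq_mem_Ioo {v : I} (hv : v = 0 ∨ v = 1) {l u : ℝ} (hl : 0 ≤ l) (hlu : l < u)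
    (hu : u ≤ 1) : ∃ a : I, decode a = v ∧ l < a ∧ (a : ℝ) < u := by
  have key : ∀ r : ℝ, l < r → r < u → ∃ a : I, (a : ℝ) = r ∧ ¬(a = 0 ∨ a = 1) := by
    intro r h1 h2
    refine ⟨⟨r, by linarith, by linarith⟩, rfl, ?_⟩
    rintro (h | h)
    · have := congrArg Subtype.val h
      simp only [Set.Icc.coe_zero] at this
      linarith
    · have := congrArg Subtype.val h
      simp only [Set.Icc.coe_one] at this
      linarith
  rcases hv with rfl | rfl
  · obtain ⟨q, h1, h2⟩ := exists_rat_btwn hlu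
    obtain ⟨a, ha, hn⟩ := key q h1 h2
    refine ⟨a, ?_, ha ▸ h1, ha ▸ h2⟩
    rw [decode, if_neg hn, if_neg (by rw [ha]; exact q.not_irrational)]
  · obtain ⟨r, hr, h1, h2⟩ := exists_irrational_btwn hlu
    obtain ⟨a, ha, hn⟩ := key r h1 h2
    refine ⟨a, ?_, ha ▸ h1, ha ▸ h2⟩
    rw [decode, if_neg hn, if_pos (ha ▸ hr)]

/-- A given bit can be hidden in a value that is almost as hard to predict as a fair coin. -/
lemma exists_decode_eq_le_sqLoss {v : I} (hv : v = 0 ∨ v = 1) (q : I) {δ : ℝ} (hδ : 0 < δ) :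
    ∃ a : I, decode a = v ∧ 1 / 4 - δ ≤ sqLoss a q := by
  set η := min δ (1 / 2) with hη
  have h0 : 0 < η := lt_min hδ (by norm_num)
  have h1 : η ≤ δ := min_le_left _ _
  have h2 : η ≤ 1 / 2 := min_le_right _ _
  rcases le_total (q : ℝ) (1 / 2) with hq | hq
  · obtain ⟨a, ha, hl, -⟩ := exists_decode_eq_mem_Ioo hv (l := 1 - η) (u := 1)
      (by linarith) (by linarith) le_rfl
    refine ⟨a, ha, ?_⟩
    simp only [sqLoss]
    nlinarith
  · obtain ⟨a, ha, -, hu⟩ := exists_decode_eq_mem_Ioo hv (l := 0) (u := η)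
      le_rfl h0 (by linarith)
    refine ⟨a, ha, ?_⟩
    simp only [sqLoss]
    nlinarith

lemma exists_endpoint_le_sqLoss (q : I) : ∃ a : I, (a = 0 ∨ a = 1) ∧ 1 / 4 ≤ sqLoss a q := by
  rcases le_total (q : ℝ) (1 / 2) with hq | hq
  · refine ⟨1, Or.inr rfl, ?_⟩
    simp only [sqLoss, Set.Icc.coe_one]
    nlinarith
  · refine ⟨0, Or.inl rfl, ?_⟩
    simp only [sqLoss, Set.Icc.coe_zero]
    nlinarith

/-- A value revealed at each step by an adversary who sees the history of the scan can be
realised by a single data array. -/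
lemma exists_forall_visits [Fintype B] [DecidableEq B] [Nonempty A]
    {Ψ : ∀ t : ℕ, (Fin t → A) → B} (hΨ : IsValidScan Ψ)
    {P : ∀ t : ℕ, (Fin t → A) → A → Prop} (hP : ∀ t h, ∃ a, P t h a) :
    ∃ x : B → A, ∀ t < Fintype.card B,
      P t (fun i : Fin t => x (visits Ψ x i)) (x (visits Ψ x t)) := by
  suffices H : ∀ k ≤ Fintype.card B, ∃ x : B → A, ∀ t < k,
      P t (fun i : Fin t => x (visits Ψ x i)) (x (visits Ψ x t)) from H _ le_rfl
  intro k
  induction k with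
  | zero => exact fun _ => ⟨fun _ => Classical.arbitrary A, fun t ht => absurd ht (by omega)⟩
  | succ k ih =>
    intro hk
    obtain ⟨x, hx⟩ := ih (by omega)
    obtain ⟨a, ha⟩ := hP k fun i : Fin k => x (visits Ψ x i)
    set x' := Function.update x (visits Ψ x k) a with hx'
    have hne : ∀ s < k, x' (visits Ψ x s) = x (visits Ψ x s) := by
      intro s hs
      refine Function.update_of_ne (fun h => ?_) _ _
      have := @(hΨ x).1 ⟨s, by omega⟩ ⟨k, by omega⟩ h
      simp only [Fin.mk.injEq] at this
      omega
    have hvis : ∀ t ≤ k, visits Ψ x' t = visits Ψ x t := by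
      intro t
      induction t using Nat.strong_induction_on with
      | _ t iht =>
        intro ht
        rw [visits, visits.eq_def Ψ x t]
        congr 1
        funext i
        rw [iht i i.2 (by have := i.2; omega), hne i (by have := i.2; omega)]
    have hhist : ∀ t ≤ k, (fun i : Fin t => x' (visits Ψ x' i)) =
        fun i : Fin t => x (visits Ψ x i) := by
      intro t ht
      funext i
      rw [hvis i (by have := i.2; omega), hne i (by have := i.2; omega)]
    refine ⟨x', fun t ht => ?_⟩
    rw [hhist t (by omega), hvis t (by omega)]
    rcases Nat.lt_succ_iff_lt_or_eq.mp ht with h | rfl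
    · rw [hne t h]
      exact hx t h
    · rw [hx', Function.update_self]
      exact ha

/-- The scandictor that visits the sites in the order `e`, and predicts a site from the bit hidden
in its mirror image whenever the latter has already been visited. -/
noncomputable def mirrorScandictor [Fintype B] [Nonempty B] (e : Fin (Fintype.card B) ≃ B) :
    Scandictor I I B where
  scan t _ := if h : t < Fintype.card B then e ⟨t, h⟩ else Classical.arbitrary B
  pred t h := if hlt : Fintype.card B - (t + 1) < t then decode (h ⟨_, hlt⟩) else half
  valid x := by
    convert e.bijective using 2 with t
    rw [visits, dif_pos t.2]

lemma sLoss_mirrorScandictor [Fintype B] [Nonempty B] (e : Fin (Fintype.card B) ≃ B) (x : B → I) :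
    sLoss sqLoss (mirrorScandictor e) x =
      ∑ t : Fin (Fintype.card B),
        sqLoss (x (e t)) (if t.rev < t then decode (x (e t.rev)) else half) := by
  have hv : ∀ t (h : t < Fintype.card B), visits (mirrorScandictor e).scan x t = e ⟨t, h⟩ := by
    intro t h
    rw [visits]
    exact dif_pos h
  rw [sLoss, cumLoss]
  refine Finset.sum_congr rfl fun t _ => ?_
  rw [hv t t.2]
  congr 1
  simp only [mirrorScandictor]
  have hiff : t.rev < t ↔ Fintype.card B - (t.1 + 1) < t.1 := by
    rw [Fin.lt_def, Fin.val_rev]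
  by_cases h : t.rev < t
  · rw [if_pos h, dif_pos (hiff.mp h)]
    congr 2
    exact hv _ (by have := t.2; omega)
  · rw [if_neg h, dif_neg (fun h' => h (hiff.mpr h'))]

/-- In every mirror pair, one of the sites carries an endpoint that is hidden in the other. -/
def MirrorCoded {N : ℕ} (y : Fin N → I) : Prop :=
  ∀ i : Fin N, i.rev ≠ i → ((y i = 0 ∨ y i = 1) ∧ decode (y i.rev) = y i) ∨
    ((y i.rev = 0 ∨ y i.rev = 1) ∧ decode (y i) = y i.rev)

lemma sum_sqLoss_mirror_le {N : ℕ} {y : Fin N → I} (hy : MirrorCoded y) :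
    ∑ i : Fin N, (sqLoss (y i) (if i.rev < i then decode (y i.rev) else half) +
      sqLoss (y i) (if i < i.rev then decode (y i.rev) else half)) ≤ 3 / 8 * (N : ℝ) + 1 / 8 := by
  set G : Fin N → ℝ := fun i => sqLoss (y i) (if i.rev < i then decode (y i.rev) else half) +
      sqLoss (y i) (if i < i.rev then decode (y i.rev) else half) with hG
  have hG_ne : ∀ i : Fin N, i.rev ≠ i →
      G i = sqLoss (y i) half + sqLoss (y i) (decode (y i.rev)) := by
    intro i hi
    rcases lt_or_gt_of_ne hi with h | h
    · simp only [hG, if_pos h, if_neg h.asymm]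
      ring
    · simp only [hG, if_pos h, if_neg h.asymm]
  have hle : ∀ i, G i + G i.rev ≤ 3 / 4 + if i.rev = i then 1 / 4 else 0 := by
    intro i
    have h1 := sqLoss_half_le (y i)
    have h2 := sqLoss_half_le (y i.rev)
    by_cases hi : i.rev = i
    · rw [if_pos hi, hi]
      simp only [hG, hi, lt_irrefl, if_false]
      linarith
    · rw [if_neg hi, hG_ne i hi, hG_ne i.rev (by rw [Fin.rev_rev]; exact Ne.symm hi), Fin.rev_rev]
      rcases hy i hi with ⟨he, hd⟩ | ⟨he, hd⟩
      · rw [hd, decode_of_endpoint he, sqLoss_self]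
        linarith
      · rw [hd, decode_of_endpoint he, sqLoss_self]
        linarith
  have hrev : ∑ i : Fin N, G i.rev = ∑ i, G i := Equiv.sum_comp Fin.revPerm G
  have hsum := Finset.sum_le_sum fun (i : Fin N) (_ : i ∈ Finset.univ) => hle i
  have hcard : (Finset.univ.filter fun i : Fin N => i.rev = i).card ≤ 1 := by
    refine Finset.card_le_one.mpr fun a ha b hb => ?_
    simp only [Finset.mem_filter, Finset.mem_univ, true_and, Fin.ext_iff, Fin.val_rev] at ha hb
    ext
    omega
  have hcard' : ((Finset.univ.filter fun i : Fin N => i.rev = i).card : ℝ) ≤ 1 := by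
    exact_mod_cast hcard
  clear_value G
  rw [Finset.sum_add_distrib, Finset.sum_add_distrib, hrev, ← Finset.sum_filter, Finset.sum_const,
    Finset.sum_const, Finset.card_univ, Fintype.card_fin, nsmul_eq_mul, nsmul_eq_mul] at hsum
  linarith

lemma min_sLoss_mirrorScandictor_le [Fintype B] [Nonempty B] (e : Fin (Fintype.card B) ≃ B)
    {x : B → I} (hx : MirrorCoded fun i => x (e i)) :
    min (sLoss sqLoss (mirrorScandictor e) x)
      (sLoss sqLoss (mirrorScandictor (Fin.revPerm.trans e)) x) ≤
        3 / 16 * (Fintype.card B : ℝ) + 1 / 16 := by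
  have h2 : sLoss sqLoss (mirrorScandictor (Fin.revPerm.trans e)) x =
      ∑ i : Fin (Fintype.card B),
        sqLoss (x (e i)) (if i < i.rev then decode (x (e i.rev)) else half) := by
    rw [sLoss_mirrorScandictor, ← Equiv.sum_comp Fin.revPerm]
    simp
  have h := sum_sqLoss_mirror_le hx
  rw [Finset.sum_add_distrib, ← h2, ← sLoss_mirrorScandictor] at h
  have := min_le_left (sLoss sqLoss (mirrorScandictor e) x)
    (sLoss sqLoss (mirrorScandictor (Fin.revPerm.trans e)) x)
  have := min_le_right (sLoss sqLoss (mirrorScandictor e) x)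
    (sLoss sqLoss (mirrorScandictor (Fin.revPerm.trans e)) x)
  linarith

/-- Every scandictor has a mirror-coded image on which it does almost as badly as on coin flips:
of the two sites of a mirror pair, the one visited later hides the value of the earlier one. -/
lemma exists_mirrorCoded_le_sLoss [Fintype B] [DecidableEq B] (e : Fin (Fintype.card B) ≃ B)
    (S : Scandictor I I B) {δ : ℝ} (hδ : 0 < δ) :
    ∃ x : B → I, MirrorCoded (fun i => x (e i)) ∧
      (1 / 4 - δ) * (Fintype.card B : ℝ) ≤ sLoss sqLoss S x := by
  let M : ∀ t : ℕ, (Fin t → I) → Fin t → Prop := fun t h s =>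
    S.scan s (fun j : Fin s => h ⟨j, j.2.trans s.2⟩) = e (e.symm (S.scan t h)).rev
  obtain ⟨x, hx⟩ := exists_forall_visits S.valid
    (P := fun t h a => 1 / 4 - δ ≤ sqLoss a (S.pred t h) ∧
      ((∃ s, M t h s ∧ (h s = 0 ∨ h s = 1 → decode a = h s)) ∨
        ((¬ ∃ s, M t h s) ∧ (a = 0 ∨ a = 1)))) (by
    intro t h
    obtain ⟨a, ha, hl⟩ := exists_endpoint_le_sqLoss (S.pred t h)
    by_cases hs : ∃ s, M t h s
    · obtain ⟨s, hs⟩ := hs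
      by_cases hv : h s = 0 ∨ h s = 1
      · obtain ⟨b, hb, hl⟩ := exists_decode_eq_le_sqLoss hv (S.pred t h) hδ
        exact ⟨b, hl, Or.inl ⟨s, hs, fun _ => hb⟩⟩
      · exact ⟨a, by linarith, Or.inl ⟨s, hs, fun h => absurd h hv⟩⟩
    · exact ⟨a, by linarith, Or.inr ⟨hs, ha⟩⟩)
  have hM : ∀ (t : ℕ) (s : Fin t), M t (fun i : Fin t => x (visits S.scan x i)) s ↔
      visits S.scan x s = e (e.symm (visits S.scan x t)).rev := by
    intro t s
    rw [visits.eq_def S.scan x s, visits.eq_def S.scan x t]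
  simp only [hM] at hx
  have hinj : ∀ s t, s < Fintype.card B → t < Fintype.card B →
      visits S.scan x s = visits S.scan x t → s = t := by
    intro s t hs ht h
    simpa using @(S.valid x).1 ⟨s, hs⟩ ⟨t, ht⟩ h
  have hpair : ∀ (i : Fin (Fintype.card B)) (s t : ℕ), s < t → t < Fintype.card B →
      visits S.scan x s = e i → visits S.scan x t = e i.rev →
      (x (e i) = 0 ∨ x (e i) = 1) ∧ decode (x (e i.rev)) = x (e i) := by
    intro i s t hst ht hs hi
    have hend : x (e i) = 0 ∨ x (e i) = 1 := by
      rcases (hx s (hst.trans ht)).2 with ⟨s', h, -⟩ | ⟨-, h⟩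
      · rw [hs, e.symm_apply_apply, ← hi] at h
        have := hinj _ _ (by have := s'.2; omega) ht h
        have := s'.2
        omega
      · rwa [hs] at h
    refine ⟨hend, ?_⟩
    rcases (hx t ht).2 with ⟨s', h, hd⟩ | ⟨h, -⟩
    · rw [hi, e.symm_apply_apply, Fin.rev_rev] at h
      rw [h, hi] at hd
      exact hd hend
    · refine absurd ⟨⟨s, hst⟩, ?_⟩ h
      rw [hi, e.symm_apply_apply, Fin.rev_rev]
      exact hs
  refine ⟨x, fun i hi => ?_, ?_⟩
  · obtain ⟨s, hs⟩ := (S.valid x).2 (e i)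
    obtain ⟨t, ht⟩ := (S.valid x).2 (e i.rev)
    rcases lt_trichotomy s t with h | h | h
    · exact Or.inl (hpair i s t h t.2 hs ht)
    · exact absurd (e.injective (ht.symm.trans (h ▸ hs))) hi
    · have := hpair i.rev t s h s.2 ht (by rw [Fin.rev_rev]; exact hs)
      rw [Fin.rev_rev] at this
      exact Or.inr this
  · have h := Finset.sum_le_sum fun (t : Fin (Fintype.card B)) (_ : t ∈ Finset.univ) => (hx t t.2).1
    rw [Finset.sum_const, Finset.card_univ, Fintype.card_fin, nsmul_eq_mul] at h
    rw [mul_comm]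
    exact h

/-- With alphabet and prediction space `A = D = [0,1]` and squared-error
loss, there exist two scandictors `(Ψ,F)₁, (Ψ,F)₂` for each `V_n` (here `V_n` is the
`(n+1) × (n+1)` square `Fin (n+1) × Fin (n+1)`) such that for every `ε > 0` there is `N`
such that for all `n ≥ N` and every scandictor `(Ψ,F)` for `V_n` there exists an individual
image `x ∈ [0,1]^{V_n}` with
`L_{(Ψ,F)}(x) − min( L_{(Ψ,F)₁}(x), L_{(Ψ,F)₂}(x) ) ≥ (1/16 − ε)·|V_n|`. -/
theorem statement0 :
    ∃ S₁ S₂ : (n : ℕ) → Scandictor unitInterval unitInterval (Fin (n + 1) × Fin (n + 1)),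
      ∀ ε : ℝ, 0 < ε → ∃ N : ℕ, ∀ n : ℕ, N ≤ n →
        ∀ S : Scandictor unitInterval unitInterval (Fin (n + 1) × Fin (n + 1)),
          ∃ x : Fin (n + 1) × Fin (n + 1) → unitInterval,
            (1 / 16 - ε) * ((n : ℝ) + 1) ^ 2 ≤
              sLoss sqLoss S x - min (sLoss sqLoss (S₁ n) x) (sLoss sqLoss (S₂ n) x) := by
  let e (n : ℕ) := (Fintype.equivFin (Fin (n + 1) × Fin (n + 1))).symm
  refine ⟨fun n => mirrorScandictor (e n),
    fun n => mirrorScandictor (Fin.revPerm.trans (e n)), fun ε hε => ?_⟩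
  obtain ⟨N, hN⟩ := exists_nat_gt (1 / ε)
  refine ⟨N, fun n hn S => ?_⟩
  obtain ⟨x, hx, hS⟩ := exists_mirrorCoded_le_sLoss (e n) S (half_pos hε)
  refine ⟨x, ?_⟩
  have hmin := min_sLoss_mirrorScandictor_le (e n) hx
  have hcard : (Fintype.card (Fin (n + 1) × Fin (n + 1)) : ℝ) = ((n : ℝ) + 1) ^ 2 := by
    simp [sq]
  rw [hcard] at hS hmin
  have hn' : (N : ℝ) ≤ n := by exact_mod_cast hn
  have h1 : 1 ≤ ε * n := by
    rw [div_lt_iff₀ hε] at hN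
    nlinarith
  have h2 : ε * n ≤ ε * ((n : ℝ) + 1) ^ 2 := by
    have : (0 : ℝ) ≤ n := n.cast_nonneg
    exact mul_le_mul_of_nonneg_left (by nlinarith) hε.le
  linarith

end Scandiction
end

section
/- Let A be a finite alphabet augmented by an End-of-File symbol, l : A × D → [0, l_max] a bounded loss function, and Q a stationary probability measure on A^{ℤ²}. For S ≥ 1 let F_S be the set of all finite-state scandictors with at most S states that are valid scandictors for each V_n (visit every site of V_n exactly once). Then lim_{S→∞} limsup_{n→∞} min_{(Ψ,F)∈F_S} E_{Q_{V_n}}[(1/n²) L_{(Ψ,F)}(X_{V_n})] = lim_{S→∞} liminf_{n→∞} min_{(Ψ,F)∈F_S} E_{Q_{V_n}}[(1/n²) L_{(Ψ,F)}(X_{V_n})] = U(l,Q); that is, the scandictability of any spatially stationary source is asymptotically achieved by finite-state scandictors. -/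
open MeasureTheory Filter Real

namespace Scandiction

variable {A D B : Type*}

/-- Restriction of a configuration on `ℤ²` to the `n × n` square `V_n`. -/
def restrV {A : Type*} (n : ℕ) (x : ℤ × ℤ → A) : Fin n × Fin n → A :=
  fun p => x ((p.1 : ℤ), (p.2 : ℤ))

/-- Translation of a configuration by `i ∈ ℤ²`: `(τ_i x)_j = x_{j+i}`. -/
def shift {A : Type*} (i : ℤ × ℤ) (x : ℤ × ℤ → A) : ℤ × ℤ → A := fun j => x (j + i)

/-- A probability measure on `A^{ℤ²}` is stationary if it is invariant under every
translation. -/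
def Stationary {A : Type*} [MeasurableSpace A]
    (Q : MeasureTheory.Measure ((ℤ × ℤ) → A)) : Prop :=
  ∀ i : ℤ × ℤ, MeasureTheory.Measure.map (shift i) Q = Q

/-- The `n × n` scandictability of `Q`:
`U(l, Q_{V_n}) = inf over scandictors of E[(1/n²) L]`. -/
noncomputable def Uval {A D : Type*} [MeasurableSpace A]
    (l : A → D → ℝ) (Q : MeasureTheory.Measure ((ℤ × ℤ) → A)) (n : ℕ) : ℝ :=
  ⨅ S : Scandictor A D (Fin n × Fin n),
    ∫ x, sLoss l S (restrV n x) / (n : ℝ) ^ 2 ∂Q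

/-- A finite-state scandictor with state space `σ`: an initial site `p0`, an initial state
`s0`, a next-state function (observing the alphabet augmented by the End-of-File symbol,
modeled by `Option A` with `none` = EoF), a displacement function, and a prediction
function. -/
structure FSScandictor (A D σ : Type*) where
  s0 : σ
  next : σ → Option A → σ
  disp : σ → ℤ × ℤ
  pred : σ → D
  p0 : ℤ × ℤ

/-- The array `x` on `V_n` extended to `ℤ²` by End-of-File symbols. -/
def extArr {A : Type*} (n : ℕ) (x : Fin n × Fin n → A) : ℤ × ℤ → Option A :=
  fun p =>
    if h : 0 ≤ p.1 ∧ p.1 < (n : ℤ) ∧ 0 ≤ p.2 ∧ p.2 < (n : ℤ) then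
      some (x (⟨p.1.toNat, by omega⟩, ⟨p.2.toNat, by omega⟩))
    else none

/-- Trajectory of the finite-state machine on the observed configuration `o`:
`fsWalk M o t = (Ψ_{t+1}, s_t)`, the site visited at time `t+1` and the state used for the
prediction at that site; at step `t` it observes the value at the current site, updates the
state, and moves by the corresponding displacement. -/
def fsWalk {A D σ : Type*} (M : FSScandictor A D σ) (o : ℤ × ℤ → Option A) :
    ℕ → (ℤ × ℤ) × σ
  | 0 => (M.p0, M.s0)
  | t + 1 =>
      let ps := fsWalk M o t
      let s' := M.next ps.2 (o ps.1)
      (ps.1 + M.disp s', s')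

def toSite {n : ℕ} (v : Fin n × Fin n) : ℤ × ℤ := ((v.1.1 : ℤ), (v.2.1 : ℤ))

/-- The machine is a valid scandictor for `V_n`: on every data array it visits every site
of `V_n` exactly once. -/
def FSValidOn {A D σ : Type*} (n : ℕ) (M : FSScandictor A D σ) : Prop :=
  ∀ (x : Fin n × Fin n → A) (v : Fin n × Fin n),
    ∃! t : ℕ, (fsWalk M (extArr n x) t).1 = toSite v

/-- Cumulative loss of a finite-state scandictor on the array `x` over `V_n` (sites outside
`V_n` carry the EoF symbol and incur no loss). -/
noncomputable def fsLoss {A D σ : Type*} (n : ℕ) (M : FSScandictor A D σ)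
    (hval : FSValidOn n M) (l : A → D → ℝ) (x : Fin n × Fin n → A) : ℝ :=
  ∑ v : Fin n × Fin n,
    l (x v) (M.pred (fsWalk M (extArr n x) (Classical.choose (hval x v))).2)

section Mealy

/-- Trajectory of a machine whose displacement may depend on the current state and on the
observation. -/
def mealyWalk {τ : Type*} (p0 : ℤ × ℤ) (s0 : τ) (next : τ → Option A → τ)
    (disp : τ → Option A → ℤ × ℤ) (o : ℤ × ℤ → Option A) : ℕ → (ℤ × ℤ) × τ
  | 0 => (p0, s0)
  | t + 1 =>
      let c := mealyWalk p0 s0 next disp o t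
      (c.1 + disp c.2 (o c.1), next c.2 (o c.1))

/-- Every finite machine with observation-dependent displacements is simulated by a
finite-state scandictor with any sufficiently large number of states. -/
theorem exists_fsScandictor_of_mealy [Finite A] {τ : Type*} [Finite τ] (p0 : ℤ × ℤ) (s0 : τ)
    (next : τ → Option A → τ) (disp : τ → Option A → ℤ × ℤ) (pred : τ → D) :
    ∃ S₀ : ℕ, ∀ S ≥ S₀, ∃ M : FSScandictor A D (Fin S), ∀ o t,
      (fsWalk M o t).1 = (mealyWalk p0 s0 next disp o t).1 ∧
      M.pred (fsWalk M o t).2 = pred (mealyWalk p0 s0 next disp o t).2 := by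
  classical
  have : Fintype A := Fintype.ofFinite A
  have : Fintype τ := Fintype.ofFinite τ
  refine ⟨Fintype.card (Option (τ × Option A)), fun S hS => ?_⟩
  obtain ⟨e⟩ : Nonempty (Option (τ × Option A) ↪ Fin S) :=
    Function.Embedding.nonempty_of_card_le (by simpa using hS)
  let r : Fin S → Option (τ × Option A) := Function.invFun e
  have hr : ∀ a, r (e a) = a := Function.leftInverse_invFun e.injective
  let cur : Option (τ × Option A) → τ := fun s => s.elim s0 fun q => next q.1 q.2
  let M : FSScandictor A D (Fin S) :=
    { s0 := e none
      next := fun s o => e (some (cur (r s), o))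
      disp := fun s => (r s).elim 0 fun q => disp q.1 q.2
      pred := fun s => pred (cur (r s))
      p0 := p0 }
  have key : ∀ o t, (fsWalk M o t).1 = (mealyWalk p0 s0 next disp o t).1 ∧
      cur (r (fsWalk M o t).2) = (mealyWalk p0 s0 next disp o t).2 := by
    intro o t
    induction t with
    | zero => simp [fsWalk, mealyWalk, M, hr, cur]
    | succ t ih =>
      obtain ⟨h1, h2⟩ := ih
      simp only [fsWalk, mealyWalk]
      rw [← h1, ← h2]
      simp [M, hr, cur]
  exact ⟨M, fun o t => ⟨(key o t).1, congrArg pred (key o t).2⟩⟩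

end Mealy

section Serpentine

/-- One move of the serpentine walk: advance horizontally in the current direction while inside
the square, otherwise turn around into the next row. -/
def serpMove (dir act : Bool) : (ℤ × ℤ) × Bool :=
  match dir, act with
  | true, true => ((1, 0), true)
  | true, false => ((-1, 1), false)
  | false, true => ((-1, 0), false)
  | false, false => ((1, 1), true)

/-- Membership in the square `{0, …, N - 1}²`. -/
def inSquare (N : ℕ) (b : ℤ × ℤ) : Prop :=
  0 ≤ b.1 ∧ b.1 < (N : ℤ) ∧ 0 ≤ b.2 ∧ b.2 < (N : ℤ)

instance (N : ℕ) (b : ℤ × ℤ) : Decidable (inSquare N b) := by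
  unfold inSquare; infer_instance

/-- The serpentine walk through the square `{0, …, N - 1}²`, with its current direction. -/
def serp (N : ℕ) : ℕ → (ℤ × ℤ) × Bool
  | 0 => ((0, 0), true)
  | t + 1 =>
      let p := serp N t
      let mv := serpMove p.2 (decide (inSquare N p.1))
      (p.1 + mv.1, mv.2)

theorem serp_right {N t : ℕ} {y : ℕ} (hy : y < N) (h : serp N t = ((0, (y : ℤ)), true)) :
    ∀ k ≤ N, serp N (t + k) = (((k : ℤ), (y : ℤ)), true) := by
  intro k hk
  induction k with
  | zero => simpa using h
  | succ k ih =>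
    have ih := ih (by omega)
    have hin : inSquare N ((k : ℤ), (y : ℤ)) := by
      simp only [inSquare]; omega
    rw [← add_assoc]
    simp [serp, ih, hin, serpMove]

theorem serp_left {N t : ℕ} {y : ℕ} (hy : y < N)
    (h : serp N t = (((N : ℤ) - 1, (y : ℤ)), false)) :
    ∀ k ≤ N, serp N (t + k) = (((N : ℤ) - 1 - k, (y : ℤ)), false) := by
  intro k hk
  induction k with
  | zero => simpa using h
  | succ k ih =>
    have ih := ih (by omega)
    have hin : inSquare N ((N : ℤ) - 1 - k, (y : ℤ)) := by
      simp only [inSquare]; omega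
    rw [← add_assoc]
    simp [serp, ih, hin, serpMove]
    ring

theorem serp_row_start (N y : ℕ) (hy : y ≤ N) :
    serp N (y * (N + 1)) =
      if Even y then ((0, (y : ℤ)), true) else (((N : ℤ) - 1, (y : ℤ)), false) := by
  induction y with
  | zero => simp [serp]
  | succ y ih =>
    have ih := ih (by omega)
    have e : (y + 1) * (N + 1) = y * (N + 1) + N + 1 := by ring
    rw [e]
    by_cases hev : Even y
    · rw [if_pos hev] at ih
      have h1 := serp_right (by omega) ih N le_rfl
      have hin : ¬ inSquare N ((N : ℤ), (y : ℤ)) := by simp only [inSquare]; omega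
      simp [serp, h1, hin, serpMove, Nat.even_add_one, hev]
      ring
    · rw [if_neg hev] at ih
      have h1 := serp_left (by omega) ih N le_rfl
      rw [show (N : ℤ) - 1 - N = -1 by ring] at h1
      have hin : ¬ inSquare N (-1, (y : ℤ)) := by simp only [inSquare]; omega
      simp [serp, h1, hin, serpMove, Nat.even_add_one, hev]

theorem serp_eq (N y k : ℕ) (hy : y < N) (hk : k ≤ N) :
    (serp N (y * (N + 1) + k)).1 =
      if Even y then ((k : ℤ), (y : ℤ)) else ((N : ℤ) - 1 - k, (y : ℤ)) := by
  have h := serp_row_start N y hy.le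
  by_cases hev : Even y
  · rw [if_pos hev] at h ⊢
    rw [serp_right hy h k hk]
  · rw [if_neg hev] at h ⊢
    rw [serp_left hy h k hk]

theorem serp_late (N t : ℕ) : (N : ℤ) ≤ (serp N (N * (N + 1) + t)).1.2 := by
  induction t with
  | zero =>
    rw [add_zero, serp_row_start N N le_rfl]
    split_ifs <;> simp
  | succ t ih =>
    rw [← add_assoc]
    have hin : ¬ inSquare N (serp N (N * (N + 1) + t)).1 := by simp only [inSquare]; omega
    simp only [serp, hin, decide_false, Prod.snd_add]
    cases (serp N (N * (N + 1) + t)).2 <;> simp [serpMove] <;> omega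

/-- The serpentine walk visits every site of the square exactly once. -/
theorem existsUnique_serp (N : ℕ) (b : ℤ × ℤ) (hb : inSquare N b) :
    ∃! t : ℕ, (serp N t).1 = b := by
  obtain ⟨b1, b2⟩ := b
  obtain ⟨h1, h2, h3, h4⟩ := hb
  simp only at h1 h2 h3 h4
  lift b1 to ℕ using h1
  lift b2 to ℕ using h3
  refine ⟨b2 * (N + 1) + (if Even b2 then b1 else N - 1 - b1), ?_, ?_⟩
  · dsimp only
    rw [serp_eq N b2 _ (by omega) (by split_ifs <;> omega)]
    split_ifs
    · rfl
    · simp only [Prod.mk.injEq, and_true]; omega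
  · intro t ht
    by_cases hlt : t < N * (N + 1)
    · have hy : t / (N + 1) < N := by
        rw [Nat.div_lt_iff_lt_mul (by omega)]; exact hlt
      have hk : t % (N + 1) < N + 1 := Nat.mod_lt _ (by omega)
      have e := Nat.div_add_mod' t (N + 1)
      rw [← e, serp_eq N _ _ hy (by omega)] at ht
      generalize t / (N + 1) = y at *
      generalize t % (N + 1) = k at *
      subst e
      have hyb : y = b2 := by
        split_ifs at ht <;> simp only [Prod.mk.injEq] at ht <;> omega
      subst hyb
      split_ifs at ht ⊢ <;> simp only [Prod.mk.injEq] at ht <;> omega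
    · have := serp_late N (t - N * (N + 1))
      rw [Nat.add_sub_cancel' (by omega), ht] at this
      simp only at this
      omega

end Serpentine

section FiniteStateToScandictor

variable {σ : Type*} {n : ℕ}

theorem toSite_injective : Function.Injective (toSite (n := n)) := by
  rintro ⟨a, b⟩ ⟨c, d⟩ h
  simp only [toSite, Prod.mk.injEq, Nat.cast_inj] at h
  exact Prod.ext (Fin.ext h.1) (Fin.ext h.2)

theorem extArr_toSite (x : Fin n × Fin n → A) (v : Fin n × Fin n) :
    extArr n x (toSite v) = some (x v) := by
  have h : 0 ≤ (toSite v).1 ∧ (toSite v).1 < (n : ℤ) ∧ 0 ≤ (toSite v).2 ∧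
      (toSite v).2 < (n : ℤ) := by
    simp [toSite]
  rw [extArr, dif_pos h]
  simp [toSite]

theorem toSite_bounds (v : Fin n × Fin n) :
    0 ≤ (toSite v).1 ∧ (toSite v).1 < (n : ℤ) ∧ 0 ≤ (toSite v).2 ∧ (toSite v).2 < (n : ℤ) := by
  simp [toSite]

theorem exists_toSite_eq_iff {p : ℤ × ℤ} :
    (∃ v : Fin n × Fin n, p = toSite v) ↔ inSquare n p := by
  constructor
  · rintro ⟨v, rfl⟩
    exact toSite_bounds v
  · rintro ⟨h1, h2, h3, h4⟩
    exact ⟨(⟨p.1.toNat, by omega⟩, ⟨p.2.toNat, by omega⟩),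
      Prod.ext (by simp [toSite, h1]) (by simp [toSite, h3])⟩

theorem extArr_ne_none_iff (x : Fin n × Fin n → A) (p : ℤ × ℤ) :
    extArr n x p ≠ none ↔ inSquare n p := by
  rw [extArr]
  split_ifs with h
  · exact ⟨fun _ => h, fun _ => Option.some_ne_none _⟩
  · exact ⟨fun h' => absurd rfl h', fun h' => absurd h' h⟩

theorem extArr_of_forall_ne (x : Fin n × Fin n → A) (p : ℤ × ℤ)
    (hp : ¬ ∃ v : Fin n × Fin n, p = toSite v) : extArr n x p = none := by
  rwa [← not_ne_iff, extArr_ne_none_iff, ← exists_toSite_eq_iff]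

/-- At time `t` the machine is inside `V_n`. -/
def InV (M : FSScandictor A D σ) (x : Fin n × Fin n → A) (t : ℕ) : Prop :=
  ∃ v : Fin n × Fin n, (fsWalk M (extArr n x) t).1 = toSite v

open Classical in
/-- The time at which the machine visits `V_n` for the `i`-th time. -/
noncomputable def visitTime (M : FSScandictor A D σ) (x : Fin n × Fin n → A) (i : ℕ) : ℕ :=
  Nat.nth (InV M x) i

open Classical in
/-- The `i`-th site of `V_n` visited by the machine. -/
noncomputable def visitSite [Nonempty (Fin n × Fin n)] (M : FSScandictor A D σ)
    (x : Fin n × Fin n → A) (i : ℕ) : Fin n × Fin n :=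
  if h : InV M x (visitTime M x i) then h.choose else Classical.arbitrary _

variable {M : FSScandictor A D σ}

theorem choose_eq_of_walk_eq (hval : FSValidOn n M)
    (x : Fin n × Fin n → A) {v : Fin n × Fin n} {t : ℕ}
    (ht : (fsWalk M (extArr n x) t).1 = toSite v) : Classical.choose (hval x v) = t :=
  (hval x v).unique (Classical.choose_spec (hval x v)).1 ht

theorem lt_card_inV (hval : FSValidOn n M) (x : Fin n × Fin n → A) {i : ℕ}
    (hi : i < Fintype.card (Fin n × Fin n)) (hf : (Set.ofPred (InV M x)).Finite) :
    i < hf.toFinset.card := by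
  classical
  refine hi.trans_le ?_
  refine Finset.card_le_card_of_injOn (s := Finset.univ)
    (fun v => Classical.choose (hval x v)) ?_ ?_
  · intro v _
    simp only [Set.Finite.coe_toFinset]
    exact ⟨v, (Classical.choose_spec (hval x v)).1⟩
  · intro v _ w _ hvw
    have h1 := (Classical.choose_spec (hval x v)).1
    have h2 := (Classical.choose_spec (hval x w)).1
    simp only at hvw h1 h2
    rw [hvw] at h1
    exact toSite_injective (h1.symm.trans h2)

theorem inV_visitTime (hval : FSValidOn n M) (x : Fin n × Fin n → A) {i : ℕ}
    (hi : i < Fintype.card (Fin n × Fin n)) : InV M x (visitTime M x i) :=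
  Nat.nth_mem i (lt_card_inV hval x hi)

variable [Nonempty (Fin n × Fin n)]

theorem pos_of_inV {x : Fin n × Fin n → A} {i : ℕ} (h : InV M x (visitTime M x i)) :
    (fsWalk M (extArr n x) (visitTime M x i)).1 = toSite (visitSite M x i) := by
  rw [visitSite, dif_pos h]
  exact h.choose_spec

open Classical in
theorem walk_congr {x y : Fin n × Fin n → A} {t : ℕ}
    (h : ∀ i < t, y (visitSite M x i) = x (visitSite M x i)) (s : ℕ)
    (hs : Nat.count (InV M x) s ≤ t) :
    fsWalk M (extArr n y) s = fsWalk M (extArr n x) s ∧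
      Nat.count (InV M y) s = Nat.count (InV M x) s := by
  induction s with
  | zero => simp [fsWalk]
  | succ s ih =>
    obtain ⟨h1, h2⟩ := ih ((Nat.count_monotone _ (Nat.le_succ s)).trans hs)
    have hiff : InV M y s ↔ InV M x s := by simp only [InV, h1]
    refine ⟨?_, by simp only [Nat.count_succ, h2, hiff]⟩
    have hobs : extArr n y (fsWalk M (extArr n x) s).1 =
        extArr n x (fsWalk M (extArr n x) s).1 := by
      by_cases hin : InV M x s
      · have hc : Nat.count (InV M x) s < t := by
          rw [Nat.count_succ, if_pos hin] at hs; omega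
        have ht : visitTime M x (Nat.count (InV M x) s) = s := Nat.nth_count hin
        have hp := pos_of_inV (M := M) (x := x) (i := Nat.count (InV M x) s) (by rwa [ht])
        rw [ht] at hp
        rw [hp, extArr_toSite, extArr_toSite, h _ hc]
      · rw [extArr_of_forall_ne x _ hin, extArr_of_forall_ne y _ hin]
    simp only [fsWalk, h1, hobs]

theorem visitTime_congr (hval : FSValidOn n M) {x y : Fin n × Fin n → A} {t : ℕ}
    (ht : t < Fintype.card (Fin n × Fin n))
    (h : ∀ i < t, y (visitSite M x i) = x (visitSite M x i)) :
    visitTime M y t = visitTime M x t ∧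
      fsWalk M (extArr n y) (visitTime M y t) = fsWalk M (extArr n x) (visitTime M x t) := by
  classical
  have hc : Nat.count (InV M x) (visitTime M x t) = t :=
    Nat.count_nth (lt_card_inV hval x ht)
  obtain ⟨h1, h2⟩ := walk_congr h (visitTime M x t) hc.le
  have hin : InV M y (visitTime M x t) := by
    have := inV_visitTime hval x ht
    simpa only [InV, h1] using this
  have e : visitTime M y t = visitTime M x t := by
    have := Nat.nth_count hin
    rwa [h2, hc] at this
  exact ⟨e, by rw [e, h1]⟩

theorem visitSite_congr (hval : FSValidOn n M) {x y : Fin n × Fin n → A} {t : ℕ}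
    (ht : t < Fintype.card (Fin n × Fin n))
    (h : ∀ i < t, y (visitSite M x i) = x (visitSite M x i)) :
    visitSite M y t = visitSite M x t := by
  have h1 := pos_of_inV (inV_visitTime hval x ht)
  have h2 := pos_of_inV (inV_visitTime hval y ht)
  rw [(visitTime_congr hval ht h).2, h1] at h2
  exact (toSite_injective h2).symm

theorem visitSite_bijective (hval : FSValidOn n M) (x : Fin n × Fin n → A) :
    Function.Bijective fun t : Fin (Fintype.card (Fin n × Fin n)) => visitSite M x t.1 := by
  rw [Fintype.bijective_iff_injective_and_card]
  refine ⟨fun i j hij => ?_, by simp⟩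
  have h1 := pos_of_inV (inV_visitTime hval x i.2)
  have h2 := pos_of_inV (inV_visitTime hval x j.2)
  simp only at hij
  rw [← hij] at h2
  have e := (hval x _).unique h1 h2
  classical
  have ci : Nat.count (InV M x) (visitTime M x i) = i :=
    Nat.count_nth (lt_card_inV hval x i.2)
  have cj : Nat.count (InV M x) (visitTime M x j) = j :=
    Nat.count_nth (lt_card_inV hval x j.2)
  exact Fin.ext (by rw [← ci, ← cj, e])

open Classical in
/-- The scanner induced on `V_n` by a finite-state machine. -/
noncomputable def inducedScan (M : FSScandictor A D σ) (t : ℕ)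
    (a : Fin t → A) : Fin n × Fin n :=
  if h : ∃ x : Fin n × Fin n → A, ∀ i : Fin t, a i = x (visitSite M x i) then
    visitSite M h.choose t
  else Classical.arbitrary _

open Classical in
/-- The predictor induced on `V_n` by a finite-state machine. -/
noncomputable def inducedPred (M : FSScandictor A D σ) (t : ℕ)
    (a : Fin t → A) : D :=
  if h : ∃ x : Fin n × Fin n → A, ∀ i : Fin t, a i = x (visitSite M x i) then
    M.pred (fsWalk M (extArr n h.choose) (visitTime M h.choose t)).2
  else M.pred M.s0

theorem agree_of_observations_eq (hval : FSValidOn n M) {x y : Fin n × Fin n → A} {t : ℕ}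
    (ht : t ≤ Fintype.card (Fin n × Fin n))
    (h : ∀ i < t, x (visitSite M x i) = y (visitSite M y i)) :
    ∀ i < t, y (visitSite M x i) = x (visitSite M x i) := by
  intro i
  induction i using Nat.strong_induction_on with
  | _ i ih =>
    intro hi
    have := visitSite_congr hval (hi.trans_le ht) fun j hj => ih j hj (hj.trans hi)
    rw [← this, ← h i hi, this]

theorem inducedScan_eq (hval : FSValidOn n M) (x : Fin n × Fin n → A) {t : ℕ}
    (ht : t < Fintype.card (Fin n × Fin n)) :
    inducedScan M t (fun i => x (visitSite M x i)) = visitSite M x t := by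
  have hex : ∃ y : Fin n × Fin n → A, ∀ i : Fin t,
      x (visitSite M x i) = y (visitSite M y i) := ⟨x, fun _ => rfl⟩
  rw [inducedScan, dif_pos hex]
  exact visitSite_congr hval ht
    (agree_of_observations_eq hval ht.le fun i hi => hex.choose_spec ⟨i, hi⟩)

theorem inducedPred_eq (hval : FSValidOn n M) (x : Fin n × Fin n → A) {t : ℕ}
    (ht : t < Fintype.card (Fin n × Fin n)) :
    inducedPred (n := n) M t (fun i => x (visitSite M x i)) =
      M.pred (fsWalk M (extArr n x) (visitTime M x t)).2 := by
  have hex : ∃ y : Fin n × Fin n → A, ∀ i : Fin t,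
      x (visitSite M x i) = y (visitSite M y i) := ⟨x, fun _ => rfl⟩
  rw [inducedPred, dif_pos hex]
  rw [(visitTime_congr hval ht
    (agree_of_observations_eq hval ht.le fun i hi => hex.choose_spec ⟨i, hi⟩)).2]

theorem visits_inducedScan (hval : FSValidOn n M) (x : Fin n × Fin n → A) (t : ℕ)
    (ht : t < Fintype.card (Fin n × Fin n)) :
    visits (inducedScan (n := n) M) x t = visitSite M x t := by
  induction t using Nat.strong_induction_on with
  | _ t ih =>
    rw [visits, ← inducedScan_eq hval x ht]
    congr 1
    funext i
    rw [ih i i.2 (i.2.trans ht)]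

/-- A valid finite-state machine is, on each `V_n`, a scandictor with the same loss. -/
theorem exists_scandictor_of_fs (hval : FSValidOn n M) (l : A → D → ℝ) :
    ∃ S : Scandictor A D (Fin n × Fin n), ∀ x, sLoss l S x = fsLoss n M hval l x := by
  refine ⟨⟨inducedScan M, inducedPred (n := n) M, fun x => ?_⟩, fun x => ?_⟩
  · have := visitSite_bijective hval x
    rwa [show (fun t : Fin (Fintype.card (Fin n × Fin n)) => visitSite M x t.1) =
      fun t => visits (inducedScan (n := n) M) x t.1 from
        funext fun t => (visits_inducedScan hval x t t.2).symm] at this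
  · rw [sLoss, cumLoss, fsLoss]
    refine Fintype.sum_bijective _ (visitSite_bijective hval x) _ _ fun t => ?_
    have hobs : (fun i : Fin t.1 => x (visits (inducedScan (n := n) M) x i.1)) =
        fun i : Fin t.1 => x (visitSite M x i) :=
      funext fun i => by rw [visits_inducedScan hval x i (i.2.trans t.2)]
    dsimp only
    rw [hobs, visits_inducedScan hval x t t.2, inducedPred_eq hval x t.2,
      choose_eq_of_walk_eq hval x (pos_of_inV (inV_visitTime hval x t.2))]

end FiniteStateToScandictor

section BlockMachine

variable {m : ℕ}

/-- The state of the block machine: the direction of the serpentine walk on blocks, the time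
spent in the current block, and the observations made in the current block. -/
abbrev BlockState (A : Type*) (m : ℕ) : Type _ :=
  Bool × Fin (Fintype.card (Fin m × Fin m)) × (Fin (Fintype.card (Fin m × Fin m)) → Option A)

namespace BlockState

/-- The observations made so far, with End-of-File symbols replaced by `a₀`. -/
def past (a₀ : A) (s : BlockState A m) : Fin s.2.1.1 → A :=
  fun i => (s.2.2 (i.castLE s.2.1.2.le)).getD a₀

/-- The site within the current block. -/
def loc (S : Scandictor A D (Fin m × Fin m)) (a₀ : A) (s : BlockState A m) : Fin m × Fin m :=
  S.scan s.2.1 (s.past a₀)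

open Classical in
/-- The displacement to the next block. -/
noncomputable def blockMove (s : BlockState A m) (o : Option A) : (ℤ × ℤ) × Bool :=
  serpMove s.1 (decide (∃ i, Function.update s.2.2 s.2.1 o i ≠ none))

/-- The next state of the block machine. -/
noncomputable def step (hm : 0 < Fintype.card (Fin m × Fin m)) (s : BlockState A m)
    (o : Option A) : BlockState A m :=
  if h : s.2.1.1 + 1 < Fintype.card (Fin m × Fin m) then
    (s.1, ⟨s.2.1.1 + 1, h⟩, Function.update s.2.2 s.2.1 o)
  else ((s.blockMove o).2, ⟨0, hm⟩, Function.update s.2.2 s.2.1 o)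

/-- The displacement of the block machine. -/
noncomputable def move (hm : 0 < Fintype.card (Fin m × Fin m)) (S : Scandictor A D (Fin m × Fin m))
    (a₀ : A) (s : BlockState A m) (o : Option A) : ℤ × ℤ :=
  toSite ((s.step hm o).loc S a₀) - toSite (s.loc S a₀) +
    if s.2.1.1 + 1 < Fintype.card (Fin m × Fin m) then 0 else (m : ℤ) • (s.blockMove o).1

end BlockState

/-- The trajectory of the block machine, which runs the scandictor `S` for `V_m` on successive
`m × m` blocks, ordered by the serpentine walk. -/
noncomputable def blockWalk (hm : 0 < Fintype.card (Fin m × Fin m))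
    (S : Scandictor A D (Fin m × Fin m)) (a₀ : A) (o : ℤ × ℤ → Option A) :
    ℕ → (ℤ × ℤ) × BlockState A m :=
  mealyWalk (toSite (BlockState.loc S a₀ (true, ⟨0, hm⟩, fun _ => none)))
    (true, ⟨0, hm⟩, fun _ => none) (BlockState.step hm) (BlockState.move hm S a₀) o

/-- The data in the block `b`, with End-of-File symbols replaced by `a₀`. -/
def blockData (m : ℕ) (a₀ : A) (o : ℤ × ℤ → Option A) (b : ℤ × ℤ) : Fin m × Fin m → A :=
  fun v => (o ((m : ℤ) • b + toSite v)).getD a₀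

/-- The machine is `j` steps into the scan of the block `b`. -/
structure InBlock (S : Scandictor A D (Fin m × Fin m)) (a₀ : A) (o : ℤ × ℤ → Option A)
    (b : ℤ × ℤ) (dir : Bool) (j : ℕ) (c : (ℤ × ℤ) × BlockState A m) : Prop where
  pos : c.1 = (m : ℤ) • b + toSite (visits S.scan (blockData m a₀ o b) j)
  dir_eq : c.2.1 = dir
  time_eq : c.2.2.1.1 = j
  hist : ∀ i : Fin (Fintype.card (Fin m × Fin m)), i.1 < j →
    c.2.2.2 i = o ((m : ℤ) • b + toSite (visits S.scan (blockData m a₀ o b) i.1))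

variable {S : Scandictor A D (Fin m × Fin m)} {a₀ : A} {o : ℤ × ℤ → Option A} {b : ℤ × ℤ}
  {dir : Bool} {j : ℕ} {c : (ℤ × ℤ) × BlockState A m}

theorem past_eq {s : BlockState A m}
    (hist : ∀ i : Fin (Fintype.card (Fin m × Fin m)), i.1 < s.2.1.1 →
      s.2.2 i = o ((m : ℤ) • b + toSite (visits S.scan (blockData m a₀ o b) i.1))) :
    s.past a₀ = fun i => blockData m a₀ o b (visits S.scan (blockData m a₀ o b) i.1) := by
  funext i
  rw [BlockState.past, hist _ i.2]
  rfl

theorem loc_eq {s : BlockState A m}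
    (hist : ∀ i : Fin (Fintype.card (Fin m × Fin m)), i.1 < s.2.1.1 →
      s.2.2 i = o ((m : ℤ) • b + toSite (visits S.scan (blockData m a₀ o b) i.1))) :
    s.loc S a₀ = visits S.scan (blockData m a₀ o b) s.2.1.1 := by
  rw [BlockState.loc, past_eq hist]
  conv_rhs => rw [visits]

theorem InBlock.update_hist (h : InBlock S a₀ o b dir j c)
    (i : Fin (Fintype.card (Fin m × Fin m))) (hi : i.1 < j + 1) :
    Function.update c.2.2.2 c.2.2.1 (o c.1) i =
      o ((m : ℤ) • b + toSite (visits S.scan (blockData m a₀ o b) i.1)) := by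
  by_cases hij : i = c.2.2.1
  · subst hij
    rw [Function.update_self, h.pos, h.time_eq]
  · rw [Function.update_of_ne hij]
    refine h.hist i ?_
    have := h.time_eq
    have : i.1 ≠ c.2.2.1.1 := fun e => hij (Fin.ext e)
    omega

variable {hm : 0 < Fintype.card (Fin m × Fin m)}

theorem InBlock.loc (h : InBlock S a₀ o b dir j c) :
    c.2.loc S a₀ = visits S.scan (blockData m a₀ o b) j := by
  rw [loc_eq (o := o) (b := b) (S := S) fun i hi => h.hist i (h.time_eq ▸ hi), h.time_eq]

/-- One step inside a block. -/
theorem InBlock.succ (h : InBlock S a₀ o b dir j c)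
    (hj : j + 1 < Fintype.card (Fin m × Fin m)) :
    InBlock S a₀ o b dir (j + 1)
      (c.1 + c.2.move hm S a₀ (o c.1), c.2.step hm (o c.1)) := by
  have hlt : c.2.2.1.1 + 1 < Fintype.card (Fin m × Fin m) := by rwa [h.time_eq]
  have hstep : c.2.step hm (o c.1) =
      (c.2.1, ⟨c.2.2.1.1 + 1, hlt⟩, Function.update c.2.2.2 c.2.2.1 (o c.1)) := by
    rw [BlockState.step, dif_pos hlt]
  have ht : (c.2.step hm (o c.1)).2.1.1 = j + 1 := by rw [hstep, ← h.time_eq]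
  have hist : ∀ i : Fin (Fintype.card (Fin m × Fin m)), i.1 < j + 1 →
      (c.2.step hm (o c.1)).2.2 i =
        o ((m : ℤ) • b + toSite (visits S.scan (blockData m a₀ o b) i.1)) := by
    intro i hi
    rw [hstep]
    exact h.update_hist i hi
  refine ⟨?_, by rw [hstep]; exact h.dir_eq, ht, hist⟩
  have hl := loc_eq (S := S) (a₀ := a₀) (o := o) (b := b) fun i hi => hist i (ht ▸ hi)
  simp only [BlockState.move, if_pos hlt]
  rw [hl, ht, h.loc, h.pos]
  abel

/-- The last step inside a block leads to the first site of the next block. -/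
theorem InBlock.next (h : InBlock S a₀ o b dir j c)
    (hj : j + 1 = Fintype.card (Fin m × Fin m)) {act : Bool}
    (hact : act = true ↔ ∃ v : Fin m × Fin m, o ((m : ℤ) • b + toSite v) ≠ none) :
    InBlock S a₀ o (b + (serpMove dir act).1) (serpMove dir act).2 0
      (c.1 + c.2.move hm S a₀ (o c.1), c.2.step hm (o c.1)) := by
  have hlt : ¬ c.2.2.1.1 + 1 < Fintype.card (Fin m × Fin m) := by rw [h.time_eq]; omega
  have hmove : c.2.blockMove (o c.1) = serpMove dir act := by
    rw [BlockState.blockMove, h.dir_eq]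
    congr 1
    rw [Bool.eq_iff_iff, hact, decide_eq_true_iff]
    constructor
    · rintro ⟨i, hi⟩
      rw [h.update_hist i (i.2.trans_eq hj.symm)] at hi
      exact ⟨_, hi⟩
    · rintro ⟨v, hv⟩
      obtain ⟨i, rfl⟩ := (S.valid (blockData m a₀ o b)).2 v
      refine ⟨i, ?_⟩
      rw [h.update_hist i (i.2.trans_eq hj.symm)]
      exact hv
  have hstep : c.2.step hm (o c.1) =
      ((serpMove dir act).2, ⟨0, hm⟩, Function.update c.2.2.2 c.2.2.1 (o c.1)) := by
    rw [BlockState.step, dif_neg hlt, hmove]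
  have ht : (c.2.step hm (o c.1)).2.1.1 = 0 := by rw [hstep]
  refine ⟨?_, by rw [hstep], ht, fun i hi => absurd hi (Nat.not_lt_zero _)⟩
  have hl := loc_eq (S := S) (a₀ := a₀) (o := o) (b := b + (serpMove dir act).1)
    (s := c.2.step hm (o c.1)) fun i hi => absurd hi (by rw [ht]; exact Nat.not_lt_zero _)
  simp only [BlockState.move, if_neg hlt, hmove]
  rw [hl, ht, h.loc, h.pos, smul_add]
  abel

theorem blockWalk_inBlock (N : ℕ)
    (hN : ∀ b, inSquare N b ↔ ∃ v : Fin m × Fin m, o ((m : ℤ) • b + toSite v) ≠ none)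
    (T j : ℕ) (hj : j < Fintype.card (Fin m × Fin m)) :
    InBlock S a₀ o (serp N T).1 (serp N T).2 j
      (blockWalk hm S a₀ o (T * Fintype.card (Fin m × Fin m) + j)) := by
  have hblock : ∀ T, InBlock S a₀ o (serp N T).1 (serp N T).2 0
      (blockWalk hm S a₀ o (T * Fintype.card (Fin m × Fin m))) →
      ∀ j < Fintype.card (Fin m × Fin m), InBlock S a₀ o (serp N T).1 (serp N T).2 j
      (blockWalk hm S a₀ o (T * Fintype.card (Fin m × Fin m) + j)) := by
    intro T h j hj
    induction j with
    | zero => exact h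
    | succ j ih => exact (ih (by omega)).succ hj
  refine hblock T ?_ j hj
  clear hj j
  induction T with
  | zero =>
    rw [zero_mul]
    refine ⟨?_, rfl, rfl, fun i hi => absurd hi (Nat.not_lt_zero _)⟩
    have hl := loc_eq (S := S) (a₀ := a₀) (o := o) (b := (0, 0))
      (s := (true, ⟨0, hm⟩, fun _ => none)) fun i hi => absurd hi (Nat.not_lt_zero _)
    simp only [blockWalk, mealyWalk, serp]
    rw [hl]
    simp
  | succ T ih =>
    obtain ⟨K, hK⟩ : ∃ K, Fintype.card (Fin m × Fin m) = K + 1 := ⟨_, (Nat.succ_pred hm.ne').symm⟩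
    have h := (hblock T ih K (by omega)).next (hm := hm) hK.symm
      (act := decide (inSquare N (serp N T).1)) (by rw [decide_eq_true_iff, hN])
    have e : (T + 1) * Fintype.card (Fin m × Fin m) =
      T * Fintype.card (Fin m × Fin m) + K + 1 := by rw [add_mul, one_mul]; omega
    rw [e]
    exact h

/-- The blocks meeting `V_n` form a square. -/
theorem exists_inSquare_iff (n : ℕ) (hm : 0 < m) (x : Fin n × Fin n → A) :
    ∃ N : ℕ, ∀ b, inSquare N b ↔
      ∃ v : Fin m × Fin m, extArr n x ((m : ℤ) • b + toSite v) ≠ none := by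
  have key : ∀ a : ℤ, a < (((n + m - 1) / m : ℕ) : ℤ) ↔ a * m < n := by
    intro a
    rw [← Int.add_one_le_iff]
    push_cast [Nat.cast_sub (show 1 ≤ n + m by omega)]
    rw [Int.le_ediv_iff_mul_le (by omega), add_mul, one_mul]
    omega
  refine ⟨(n + m - 1) / m, fun b => ?_⟩
  simp only [extArr_ne_none_iff]
  have hm' : (0 : ℤ) < m := by exact_mod_cast hm
  constructor
  · rintro ⟨h1, h2, h3, h4⟩
    rw [key] at h2 h4
    refine ⟨(⟨0, hm⟩, ⟨0, hm⟩), ?_⟩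
    simp only [inSquare, toSite, Prod.fst_add, Prod.snd_add, Prod.smul_fst, Prod.smul_snd,
      smul_eq_mul, Nat.cast_zero, add_zero]
    exact ⟨by positivity, by linarith, by positivity, by linarith⟩
  · rintro ⟨v, h⟩
    obtain ⟨r1, r2, r3, r4⟩ := toSite_bounds v
    simp only [inSquare, Prod.fst_add, Prod.snd_add, Prod.smul_fst, Prod.smul_snd,
      smul_eq_mul] at h
    obtain ⟨h1, h2, h3, h4⟩ := h
    refine ⟨?_, (key _).2 (by linarith), ?_, (key _).2 (by linarith)⟩ <;>
    · by_contra! hneg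
      nlinarith

theorem exists_block_coord (hm : 0 < m) (p : ℤ × ℤ) :
    ∃ (b : ℤ × ℤ) (r : Fin m × Fin m), p = (m : ℤ) • b + toSite r := by
  have hm' : (0 : ℤ) < m := by exact_mod_cast hm
  obtain ⟨r, hr⟩ := exists_toSite_eq_iff.2 (show inSquare m (p.1 % m, p.2 % m) from
    ⟨Int.emod_nonneg _ hm'.ne', Int.emod_lt_of_pos _ hm', Int.emod_nonneg _ hm'.ne',
      Int.emod_lt_of_pos _ hm'⟩)
  refine ⟨(p.1 / m, p.2 / m), r, ?_⟩
  rw [← hr]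
  exact Prod.ext (Int.mul_ediv_add_emod _ _).symm (Int.mul_ediv_add_emod _ _).symm

theorem block_coord_unique {b b' : ℤ × ℤ} {r r' : Fin m × Fin m}
    (h : (m : ℤ) • b + toSite r = (m : ℤ) • b' + toSite r') : b = b' ∧ r = r' := by
  obtain ⟨r1, r2, r3, r4⟩ := toSite_bounds r
  obtain ⟨s1, s2, s3, s4⟩ := toSite_bounds r'
  have key : ∀ {a a' u u' : ℤ}, 0 ≤ u → u < m → 0 ≤ u' → u' < m →
      m * a + u = m * a' + u' → a = a' ∧ u = u' := by
    intro a a' u u' h1 h2 h3 h4 he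
    have e1 := congrArg (· % (m : ℤ)) he
    simp only [Int.mul_add_emod_self_left, Int.emod_eq_of_lt h1 h2,
      Int.emod_eq_of_lt h3 h4] at e1
    refine ⟨?_, e1⟩
    rw [e1] at he
    exact mul_left_cancel₀ (by omega) (add_right_cancel he)
  obtain ⟨e1, e2⟩ := key r1 r2 s1 s2 (congrArg Prod.fst h)
  obtain ⟨e3, e4⟩ := key r3 r4 s3 s4 (congrArg Prod.snd h)
  exact ⟨Prod.ext e1 e3, toSite_injective (Prod.ext e2 e4)⟩

variable [Finite A]

/-- The block machine, as a finite-state scandictor. -/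
theorem exists_blockMachine (hm : 0 < m) (S : Scandictor A D (Fin m × Fin m)) (a₀ : A) :
    ∃ S₀ : ℕ, ∀ s ≥ S₀, ∃ M : FSScandictor A D (Fin s), ∀ (n : ℕ) (x : Fin n × Fin n → A),
      ∃ N : ℕ, (∀ b, inSquare N b ↔
          ∃ v : Fin m × Fin m, extArr n x ((m : ℤ) • b + toSite v) ≠ none) ∧
        ∀ T, ∀ j < Fintype.card (Fin m × Fin m),
          let t := T * Fintype.card (Fin m × Fin m) + j
          let y := blockData m a₀ (extArr n x) (serp N T).1
          (fsWalk M (extArr n x) t).1 = (m : ℤ) • (serp N T).1 + toSite (visits S.scan y j) ∧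
          M.pred (fsWalk M (extArr n x) t).2 =
            S.pred j fun i : Fin j => y (visits S.scan y i.1) := by
  have hcard : 0 < Fintype.card (Fin m × Fin m) := by
    simpa using hm.ne'
  obtain ⟨S₀, hS₀⟩ := exists_fsScandictor_of_mealy
    (toSite (BlockState.loc S a₀ (true, ⟨0, hcard⟩, fun _ => none)))
    (true, ⟨0, hcard⟩, fun _ => none) (BlockState.step hcard) (BlockState.move hcard S a₀)
    (fun s => S.pred s.2.1 (BlockState.past a₀ s))
  refine ⟨S₀, fun s hs => ?_⟩
  obtain ⟨M, hM⟩ := hS₀ s hs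
  refine ⟨M, fun n x => ?_⟩
  obtain ⟨N, hN⟩ := exists_inSquare_iff n hm x
  refine ⟨N, hN, fun T j hj => ?_⟩
  have h := blockWalk_inBlock (S := S) (a₀ := a₀) (hm := hcard) N hN T j hj
  obtain ⟨h1, h2⟩ := hM (extArr n x) (T * Fintype.card (Fin m × Fin m) + j)
  refine ⟨h1.trans h.pos, h2.trans ?_⟩
  have ht := h.time_eq
  have hp := past_eq (S := S) (a₀ := a₀) fun i hi => h.hist i (hi.trans_eq ht)
  change S.pred _ (BlockState.past a₀ (blockWalk hcard S a₀ (extArr n x)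
    (T * Fintype.card (Fin m × Fin m) + j)).2) = _
  rw [hp]
  generalize (blockWalk hcard S a₀ (extArr n x)
    (T * Fintype.card (Fin m × Fin m) + j)).2.2.1.1 = k at ht
  subst ht
  rfl

/-- A finite-state machine running a fixed scandictor block by block is valid on every `V_n`,
and its loss on a complete block is the loss of that scandictor. -/
theorem exists_fs_of_scandictor (hm : 0 < m) (S : Scandictor A D (Fin m × Fin m)) (a₀ : A) :
    ∃ S₀ : ℕ, ∀ s ≥ S₀, ∃ M : FSScandictor A D (Fin s), ∃ hval : ∀ k, FSValidOn k M,
      ∀ (n : ℕ) (x : Fin n × Fin n → A) (l : A → D → ℝ) (b : ℤ × ℤ)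
        (e : Fin m × Fin m → Fin n × Fin n),
        (∀ r, toSite (e r) = (m : ℤ) • b + toSite r) →
        ∑ r, l (x (e r))
          (M.pred (fsWalk M (extArr n x) (Classical.choose (hval n x (e r)))).2) =
          sLoss l S (fun r => x (e r)) := by
  have hcard : 0 < Fintype.card (Fin m × Fin m) := by
    simpa using hm.ne'
  obtain ⟨S₀, hS₀⟩ := exists_blockMachine hm S a₀
  refine ⟨S₀, fun s hs => ?_⟩
  obtain ⟨M, hM⟩ := hS₀ s hs
  have hval : ∀ k, FSValidOn k M := by
    intro k x v
    obtain ⟨N, hN, hwalk⟩ := hM k x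
    obtain ⟨b, r, hbr⟩ := exists_block_coord hm (toSite v)
    have hb : inSquare N b := (hN b).2 ⟨r, by rw [← hbr, extArr_toSite]; simp⟩
    obtain ⟨T, hT, hT'⟩ := existsUnique_serp N b hb
    obtain ⟨j, hj⟩ := (S.valid (blockData m a₀ (extArr k x) b)).2 r
    simp only at hj hT
    refine ⟨T * Fintype.card (Fin m × Fin m) + j, ?_, fun t ht => ?_⟩
    · simp only [(hwalk T j j.2).1, hT, hj, hbr]
    · have ht' : t = (t / Fintype.card (Fin m × Fin m)) * Fintype.card (Fin m × Fin m) +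
          t % Fintype.card (Fin m × Fin m) := (Nat.div_add_mod' _ _).symm
      have hlt : t % Fintype.card (Fin m × Fin m) < Fintype.card (Fin m × Fin m) :=
        Nat.mod_lt _ hcard
      generalize t / Fintype.card (Fin m × Fin m) = T' at ht'
      generalize t % Fintype.card (Fin m × Fin m) = j' at ht' hlt
      subst ht'
      rw [(hwalk T' j' hlt).1, hbr] at ht
      obtain ⟨e1, e2⟩ := block_coord_unique ht
      obtain rfl := hT' T' e1
      rw [e1, ← hj] at e2
      have := (S.valid (blockData m a₀ (extArr k x) b)).1 (a₁ := ⟨j', hlt⟩) (a₂ := j) e2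
      rw [← this]
  refine ⟨M, hval, fun n x l b e he => ?_⟩
  obtain ⟨N, hN, hwalk⟩ := hM n x
  have hb : inSquare N b :=
    (hN b).2 ⟨(⟨0, hm⟩, ⟨0, hm⟩), by rw [← he, extArr_toSite]; simp⟩
  obtain ⟨T, hT, -⟩ := existsUnique_serp N b hb
  have hy : blockData m a₀ (extArr n x) b = fun r => x (e r) := by
    funext r
    rw [blockData, ← he, extArr_toSite]
    rfl
  rw [sLoss, cumLoss]
  symm
  refine Fintype.sum_bijective _ (S.valid fun r => x (e r)) _ _ fun j => ?_
  obtain ⟨h1, h2⟩ := hwalk T j j.2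
  simp only [hT, hy] at h1 h2
  rw [← he] at h1
  rw [choose_eq_of_walk_eq (hval n) x h1, h2]

end BlockMachine

section Expectation

variable {l : A → D → ℝ} {lmax : ℝ}

theorem mul_add_lt_mul {m q b r : ℕ} (hb : b < q) (hr : r < m) : m * b + r < q * m := by
  nlinarith

/-- The embedding of the block with index `b` into `V_n`. -/
def blockEmb {n m q : ℕ} (h : q * m ≤ n) (b : Fin q × Fin q) (r : Fin m × Fin m) :
    Fin n × Fin n :=
  (⟨m * b.1 + r.1, (mul_add_lt_mul b.1.2 r.1.2).trans_le h⟩,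
    ⟨m * b.2 + r.2, (mul_add_lt_mul b.2.2 r.2.2).trans_le h⟩)

theorem toSite_blockEmb {n m q : ℕ} (h : q * m ≤ n) (b : Fin q × Fin q) (r : Fin m × Fin m) :
    toSite (blockEmb h b r) = (m : ℤ) • toSite b + toSite r := by
  simp [toSite, blockEmb]

theorem blockEmb_injective {n m q : ℕ} (h : q * m ≤ n) :
    Function.Injective fun p : (Fin q × Fin q) × (Fin m × Fin m) => blockEmb h p.1 p.2 := by
  rintro ⟨b, r⟩ ⟨b', r'⟩ he
  have := congrArg toSite he
  simp only [toSite_blockEmb] at this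
  obtain ⟨e1, e2⟩ := block_coord_unique this
  exact Prod.ext (toSite_injective e1) e2

theorem sum_le_sum_blocks {n m q : ℕ} (h : q * m ≤ n) (f : Fin n × Fin n → ℝ)
    (hf : ∀ v, f v ≤ lmax) :
    ∑ v, f v ≤ ∑ b : Fin q × Fin q, ∑ r : Fin m × Fin m, f (blockEmb h b r) +
      lmax * ((n : ℝ) ^ 2 - ((q : ℝ) * m) ^ 2) := by
  classical
  set I : Finset (Fin n × Fin n) := Finset.univ.image
    fun p : (Fin q × Fin q) × (Fin m × Fin m) => blockEmb h p.1 p.2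
  have hI : ∑ v ∈ I, f v = ∑ b : Fin q × Fin q, ∑ r : Fin m × Fin m, f (blockEmb h b r) := by
    rw [Finset.sum_image (blockEmb_injective h).injOn, Fintype.sum_prod_type]
  have hcard : (I.card : ℝ) = ((q : ℝ) * m) ^ 2 := by
    rw [Finset.card_image_of_injective _ (blockEmb_injective h)]
    simp
    ring
  have hcompl : ((Iᶜ).card : ℝ) = (n : ℝ) ^ 2 - ((q : ℝ) * m) ^ 2 := by
    rw [Finset.card_compl, Nat.cast_sub (Finset.card_le_univ I), hcard]
    simp
    ring
  rw [← Finset.sum_add_sum_compl I, hI]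
  gcongr
  calc ∑ v ∈ Iᶜ, f v ≤ (Iᶜ).card • lmax := Finset.sum_le_card_nsmul _ _ _ fun v _ => hf v
    _ = lmax * ((n : ℝ) ^ 2 - ((q : ℝ) * m) ^ 2) := by rw [nsmul_eq_mul, hcompl, mul_comm]

theorem restrV_blockEmb {n m q : ℕ} (h : q * m ≤ n) (b : Fin q × Fin q) (z : ℤ × ℤ → A) :
    (fun r => restrV n z (blockEmb h b r)) = restrV m (shift ((m : ℤ) • toSite b) z) := by
  funext r
  change z (toSite (blockEmb h b r)) = z (toSite r + (m : ℤ) • toSite b)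
  rw [toSite_blockEmb, add_comm]

theorem fsLoss_nonneg (hl : ∀ a d, 0 ≤ l a d) {σ : Type*} {n : ℕ} {M : FSScandictor A D σ}
    (hval : FSValidOn n M) (x : Fin n × Fin n → A) : 0 ≤ fsLoss n M hval l x :=
  Finset.sum_nonneg fun _ _ => hl _ _

theorem sLoss_nonneg (hl : ∀ a d, 0 ≤ l a d) {n : ℕ} (S : Scandictor A D (Fin n × Fin n))
    (x : Fin n × Fin n → A) : 0 ≤ sLoss l S x := by
  rw [sLoss, cumLoss]
  exact Finset.sum_nonneg fun _ _ => hl _ _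

/-- Scanning in a fixed order. -/
instance [Nonempty D] (n : ℕ) : Nonempty (Scandictor A D (Fin (n + 1) × Fin (n + 1))) := by
  let e := Fintype.equivFin (Fin (n + 1) × Fin (n + 1))
  refine ⟨⟨fun t _ => if h : t < Fintype.card (Fin (n + 1) × Fin (n + 1)) then
    e.symm ⟨t, h⟩ else 0, fun _ _ => Classical.arbitrary D, fun x => ?_⟩⟩
  convert e.symm.bijective using 2 with t
  rw [visits, dif_pos t.2]

variable [MeasurableSpace A] {Q : Measure (ℤ × ℤ → A)}

theorem measurable_restrV (n : ℕ) : Measurable (restrV (A := A) n) :=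
  measurable_pi_lambda _ fun _ => measurable_pi_apply _

theorem measurable_shift (i : ℤ × ℤ) : Measurable (shift (A := A) i) :=
  measurable_pi_lambda _ fun _ => measurable_pi_apply _

/-- Every valid finite-state machine loses at least the scandictability of `V_n`. -/
theorem Uval_le_integral_fsLoss (hl : ∀ a d, 0 ≤ l a d) {n : ℕ} {σ : Type*}
    {M : FSScandictor A D σ} (hval : FSValidOn (n + 1) M) :
    Uval l Q (n + 1) ≤
      ∫ z, fsLoss (n + 1) M hval l (restrV (n + 1) z) / ((n : ℝ) + 1) ^ 2 ∂Q := by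
  obtain ⟨S, hS⟩ := exists_scandictor_of_fs hval l
  have hbdd : BddBelow (Set.range fun S : Scandictor A D (Fin (n + 1) × Fin (n + 1)) =>
      ∫ x, sLoss l S (restrV (n + 1) x) / ((n + 1 : ℕ) : ℝ) ^ 2 ∂Q) :=
    ⟨0, by
      rintro _ ⟨S, rfl⟩
      exact integral_nonneg fun z => div_nonneg (sLoss_nonneg hl S _) (by positivity)⟩
  refine (ciInf_le hbdd S).trans_eq ?_
  simp [hS]

variable [Finite A] [MeasurableSingletonClass A]

theorem integrable_comp_restrV [IsFiniteMeasure Q] {n : ℕ} (f : (Fin n × Fin n → A) → ℝ) :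
    Integrable (fun z => f (restrV n z)) Q := by
  obtain ⟨C, hC⟩ := (Set.finite_range fun x => ‖f x‖).bddAbove
  exact Integrable.of_bound
    ((measurable_of_finite f).comp (measurable_restrV n)).aestronglyMeasurable C
    (ae_of_all _ fun z => hC ⟨restrV n z, rfl⟩)

theorem integral_comp_restrV_shift (hQ : Stationary Q) {n : ℕ} (f : (Fin n × Fin n → A) → ℝ)
    (i : ℤ × ℤ) : ∫ z, f (restrV n (shift i z)) ∂Q = ∫ z, f (restrV n z) ∂Q := by
  have h := integral_map (μ := Q) (measurable_shift i).aemeasurable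
    (f := fun z => f (restrV n z))
    ((measurable_of_finite f).comp (measurable_restrV n)).aestronglyMeasurable
  rw [hQ i] at h
  exact h.symm

/-- The expected loss of a machine that runs a scandictor for `V_m` on each complete block. -/
theorem integral_fsLoss_le [IsProbabilityMeasure Q] (hQ : Stationary Q)
    (hl : ∀ a d, l a d ≤ lmax) {n m q : ℕ} (h : q * m ≤ n) {σ : Type*}
    {M : FSScandictor A D σ} (hval : FSValidOn n M) (S : Scandictor A D (Fin m × Fin m))
    (hM : ∀ (x : Fin n × Fin n → A) (b : ℤ × ℤ) (e : Fin m × Fin m → Fin n × Fin n),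
      (∀ r, toSite (e r) = (m : ℤ) • b + toSite r) →
      ∑ r, l (x (e r)) (M.pred (fsWalk M (extArr n x) (Classical.choose (hval x (e r)))).2) =
        sLoss l S (fun r => x (e r))) :
    ∫ z, fsLoss n M hval l (restrV n z) ∂Q ≤
      (q : ℝ) ^ 2 * ∫ z, sLoss l S (restrV m z) ∂Q +
        lmax * ((n : ℝ) ^ 2 - ((q : ℝ) * m) ^ 2) := by
  have hpt : ∀ z : ℤ × ℤ → A, fsLoss n M hval l (restrV n z) ≤
      ∑ b : Fin q × Fin q, sLoss l S (fun r => restrV n z (blockEmb h b r)) +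
        lmax * ((n : ℝ) ^ 2 - ((q : ℝ) * m) ^ 2) := by
    intro z
    refine (sum_le_sum_blocks h _ fun v => hl _ _).trans_eq ?_
    congr 1
    exact Finset.sum_congr rfl fun b _ => hM _ (toSite b) _ (toSite_blockEmb h b)
  have hint : ∀ b : Fin q × Fin q,
      Integrable (fun z => sLoss l S (fun r => restrV n z (blockEmb h b r))) Q :=
    fun b => integrable_comp_restrV fun x => sLoss l S (fun r => x (blockEmb h b r))
  have hsum := integrable_finsetSum Finset.univ fun b _ => hint b
  calc ∫ z, fsLoss n M hval l (restrV n z) ∂Q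
      ≤ ∫ z, (∑ b : Fin q × Fin q, sLoss l S (fun r => restrV n z (blockEmb h b r)) +
          lmax * ((n : ℝ) ^ 2 - ((q : ℝ) * m) ^ 2)) ∂Q :=
        integral_mono (integrable_comp_restrV _) (hsum.add (integrable_const _)) hpt
    _ = _ := by
        rw [integral_add hsum (integrable_const _), integral_finsetSum _ fun b _ => hint b]
        simp only [restrV_blockEmb, integral_comp_restrV_shift hQ]
        simp only [integral_const, Finset.sum_const, Finset.card_univ, Fintype.card_prod,
          Fintype.card_fin, nsmul_eq_mul, smul_eq_mul, probReal_univ, one_mul, Nat.cast_mul, sq]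

end Expectation

/-- Convergence to `u` of a family that is bounded below by a sequence tending to `u` and
eventually nearly bounded above by `u`. -/
theorem tendsto_limsup_liminf {f : ℕ → ℕ → ℝ} {g : ℕ → ℝ} {u : ℝ} (hg : Tendsto g atTop (nhds u))
    (hlow : ∀ᶠ S in atTop, ∀ n, g n ≤ f S n)
    (hup : ∀ ε > 0, ∀ᶠ S in atTop, ∀ᶠ n in atTop, f S n ≤ u + ε) :
    Tendsto (fun S => limsup (f S) atTop) atTop (nhds u) ∧
      Tendsto (fun S => liminf (f S) atTop) atTop (nhds u) := by
  have key : ∀ ε > 0, ∀ᶠ S in atTop, u - ε ≤ liminf (f S) atTop ∧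
      liminf (f S) atTop ≤ limsup (f S) atTop ∧ limsup (f S) atTop ≤ u + ε := by
    intro ε hε
    filter_upwards [hlow, hup ε hε] with S h1 h2
    have h3 : ∀ᶠ n in atTop, u - ε ≤ f S n := by
      filter_upwards [hg.eventually (lt_mem_nhds (show u - ε < u by linarith))] with n hn
      exact hn.le.trans (h1 n)
    have b1 : IsBoundedUnder (· ≥ ·) atTop (f S) := ⟨_, h3⟩
    have b2 : IsBoundedUnder (· ≤ ·) atTop (f S) := ⟨_, h2⟩
    exact ⟨le_liminf_of_le b2.isCoboundedUnder_ge h3, liminf_le_limsup b2 b1,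
      limsup_le_of_le b1.isCoboundedUnder_le h2⟩
  constructor <;>
  · rw [Metric.tendsto_atTop']
    intro ε hε
    obtain ⟨S₀, hS₀⟩ := eventually_atTop.1 (key (ε / 2) (by linarith))
    refine ⟨S₀, fun S hS => ?_⟩
    obtain ⟨h1, h2, h3⟩ := hS₀ S hS.le
    rw [Real.dist_eq, abs_lt]
    constructor <;> linarith

/-- The complete `m × m` blocks asymptotically fill `V_n`. -/
theorem tendsto_blocks_density {m : ℕ} (hm : 0 < m) :
    Tendsto (fun n : ℕ => (((((n + 1) / m : ℕ) : ℝ) * m) / ((n : ℝ) + 1)) ^ 2) atTop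
      (nhds 1) := by
  have h0 : Tendsto (fun n : ℕ => 1 - (m : ℝ) / ((n : ℝ) + 1)) atTop (nhds 1) := by
    have h := (tendsto_one_div_add_atTop_nhds_zero_nat (𝕜 := ℝ)).const_mul (m : ℝ)
    simpa [div_eq_mul_inv] using h.const_sub 1
  have h1 : Tendsto (fun n : ℕ => ((((n + 1) / m : ℕ) : ℝ) * m) / ((n : ℝ) + 1)) atTop
      (nhds 1) := by
    refine tendsto_of_tendsto_of_tendsto_of_le_of_le h0 tendsto_const_nhds ?_ ?_ <;> intro n
    · have h2 : n + 1 ≤ (n + 1) / m * m + m := by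
        have := Nat.div_add_mod' (n + 1) m
        have := Nat.mod_lt (n + 1) hm
        omega
      have h3 : (n : ℝ) + 1 ≤ (((n + 1) / m : ℕ) : ℝ) * m + m := by exact_mod_cast h2
      have h4 : (0 : ℝ) < (n : ℝ) + 1 := by positivity
      dsimp only
      rw [le_div_iff₀ h4, sub_mul, div_mul_cancel₀ _ h4.ne']
      linarith
    · have h3 : (((n + 1) / m : ℕ) : ℝ) * m ≤ (n : ℝ) + 1 := by
        exact_mod_cast Nat.div_mul_le_self (n + 1) m
      exact div_le_one_of_le₀ h3 (by positivity)
  simpa using h1.pow 2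

/-- (Sizes are parameterized as `(n+1) × (n+1)`; `F_S` is the set of all
finite-state scandictors with at most `S` states — state space `Fin S` — that are valid
scandictors for every `V_n`.)  For every stationary probability measure `Q` with
scandictability `u = U(l,Q) = lim_n U(l, Q_{V_n})`, both the `limsup` and the `liminf` (over
the array size) of the minimal normalized expected loss over `F_S` converge to `u` as
`S → ∞`. -/
theorem statement5 {A D : Type*} [Fintype A] [MeasurableSpace A] [MeasurableSingletonClass A]
    (lmax : ℝ) (l : A → D → ℝ) (hl : ∀ a d, 0 ≤ l a d ∧ l a d ≤ lmax)
    (Q : MeasureTheory.Measure ((ℤ × ℤ) → A)) (hQp : MeasureTheory.IsProbabilityMeasure Q)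
    (hQ : Stationary Q)
    (u : ℝ) (hU : Filter.Tendsto (fun n => Uval l Q (n + 1)) Filter.atTop (nhds u)) :
    Filter.Tendsto (fun S : ℕ =>
        Filter.limsup (fun n =>
          ⨅ M : {M : FSScandictor A D (Fin S) // ∀ k, FSValidOn k M},
            ∫ x, fsLoss (n + 1) M.1 (M.2 (n + 1)) l (restrV (n + 1) x) / ((n : ℝ) + 1) ^ 2 ∂Q)
          Filter.atTop)
      Filter.atTop (nhds u)
    ∧ Filter.Tendsto (fun S : ℕ =>
        Filter.liminf (fun n =>
          ⨅ M : {M : FSScandictor A D (Fin S) // ∀ k, FSValidOn k M},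
            ∫ x, fsLoss (n + 1) M.1 (M.2 (n + 1)) l (restrV (n + 1) x) / ((n : ℝ) + 1) ^ 2 ∂Q)
          Filter.atTop)
      Filter.atTop (nhds u) := by
  classical
  have hA : Nonempty A := by
    obtain ⟨z⟩ : Nonempty (ℤ × ℤ → A) := nonempty_of_isProbabilityMeasure Q
    exact ⟨z 0⟩
  obtain ⟨a₀⟩ := hA
  rcases isEmpty_or_nonempty D with hD | hD
  · have h1 : ∀ n, Uval l Q n = 0 := fun n => by
      have : IsEmpty (Scandictor A D (Fin n × Fin n)) :=
        ⟨fun S => hD.elim (S.pred 0 Fin.elim0)⟩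
      exact Real.iInf_of_isEmpty _
    have hu : u = 0 := tendsto_nhds_unique hU (by simp [h1])
    have h2 : ∀ S, IsEmpty {M : FSScandictor A D (Fin S) // ∀ k, FSValidOn k M} :=
      fun S => ⟨fun M => hD.elim (M.1.pred M.1.s0)⟩
    simp [Real.iInf_of_isEmpty, hu]
  have hl0 : ∀ a d, 0 ≤ l a d := fun a d => (hl a d).1
  have hl1 : ∀ a d, l a d ≤ lmax := fun a d => (hl a d).2
  have hlmax : 0 ≤ lmax := (hl0 a₀ (Classical.arbitrary D)).trans (hl1 _ _)
  have hup : ∀ ε > 0, ∃ S₀ : ℕ, ∀ s ≥ S₀,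
      ∃ M : {M : FSScandictor A D (Fin s) // ∀ k, FSValidOn k M}, ∀ᶠ n : ℕ in atTop,
        ∫ x, fsLoss (n + 1) M.1 (M.2 (n + 1)) l (restrV (n + 1) x) / ((n : ℝ) + 1) ^ 2 ∂Q ≤
          u + ε := by
    intro ε hε
    obtain ⟨k, hk⟩ := (hU.eventually (gt_mem_nhds (show u < u + ε / 2 by linarith))).exists
    obtain ⟨S, hS⟩ := exists_lt_of_ciInf_lt hk
    obtain ⟨S₀, hS₀⟩ := exists_fs_of_scandictor (Nat.succ_pos k) S a₀
    refine ⟨S₀, fun s hs => ?_⟩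
    obtain ⟨M, hval, hM⟩ := hS₀ s hs
    refine ⟨⟨M, hval⟩, ?_⟩
    have hden := tendsto_blocks_density (Nat.succ_pos k)
    have hrem : Tendsto (fun n : ℕ => lmax *
        (1 - (((((n + 1) / (k + 1) : ℕ) : ℝ) * (k + 1 : ℕ)) / ((n : ℝ) + 1)) ^ 2)) atTop
        (nhds 0) := by
      simpa using (hden.const_sub 1).const_mul lmax
    filter_upwards [hrem.eventually (gt_mem_nhds (half_pos hε))] with n hn
    have hq := Nat.div_mul_le_self (n + 1) (k + 1)
    have hI := integral_fsLoss_le hQ hl1 hq (hval (n + 1)) S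
      fun x b e he => hM (n + 1) x l b e he
    rw [integral_div] at hS ⊢
    set I := ∫ z, sLoss l S (restrV (k + 1) z) ∂Q
    set q : ℝ := (((n + 1) / (k + 1) : ℕ) : ℝ)
    have hn0 : (0 : ℝ) < (n : ℝ) + 1 := by positivity
    have hk0 : (0 : ℝ) < ((k + 1 : ℕ) : ℝ) := by positivity
    have hI0 : 0 ≤ I := integral_nonneg fun z => sLoss_nonneg hl0 S _
    have hle : (q * (k + 1 : ℕ) / ((n : ℝ) + 1)) ^ 2 ≤ 1 := by
      refine pow_le_one₀ (by positivity) (div_le_one_of_le₀ ?_ hn0.le)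
      have hq' : (((n + 1) / (k + 1) * (k + 1) : ℕ) : ℝ) ≤ ((n + 1 : ℕ) : ℝ) := Nat.cast_le.2 hq
      rwa [Nat.cast_mul, Nat.cast_add_one n] at hq'
    calc (∫ z, fsLoss (n + 1) M (hval (n + 1)) l (restrV (n + 1) z) ∂Q) / ((n : ℝ) + 1) ^ 2
        ≤ (q ^ 2 * I + lmax * (((n + 1 : ℕ) : ℝ) ^ 2 - (q * (k + 1 : ℕ)) ^ 2)) /
            ((n : ℝ) + 1) ^ 2 := by gcongr
      _ = (q * (k + 1 : ℕ) / ((n : ℝ) + 1)) ^ 2 * (I / ((k + 1 : ℕ) : ℝ) ^ 2) +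
            lmax * (1 - (q * (k + 1 : ℕ) / ((n : ℝ) + 1)) ^ 2) := by
          push_cast at hk0 ⊢
          field_simp
      _ ≤ 1 * (I / ((k + 1 : ℕ) : ℝ) ^ 2) + ε / 2 := by gcongr
      _ ≤ u + ε := by linarith
  refine tendsto_limsup_liminf hU ?_ fun ε hε => ?_
  · obtain ⟨S₀, hS₀⟩ := hup 1 one_pos
    filter_upwards [eventually_ge_atTop S₀] with s hs n
    obtain ⟨M, -⟩ := hS₀ s hs
    have : Nonempty {M : FSScandictor A D (Fin s) // ∀ k, FSValidOn k M} := ⟨M⟩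
    exact le_ciInf fun M => Uval_le_integral_fsLoss hl0 (M.2 (n + 1))
  · obtain ⟨S₀, hS₀⟩ := hup ε hε
    filter_upwards [eventually_ge_atTop S₀] with s hs
    obtain ⟨M, hM⟩ := hS₀ s hs
    filter_upwards [hM] with n hn
    refine (ciInf_le ⟨0, ?_⟩ M).trans hn
    rintro _ ⟨M, rfl⟩
    exact integral_nonneg fun z => div_nonneg (fsLoss_nonneg hl0 _ _) (by positivity)

end Scandiction
end
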